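/- Let r, m be positive integers, α_1,…,α_m nonzero pairwise distinct algebraic numbers, K = ℚ(α_1,…,α_m), and x ∈ ℚ not a negative integer. For a positive integer n, let Δ_n(z) be the determinant of the (rm+1)×(rm+1) matrix whose (l+1)-st column, for 0 ≤ l ≤ rm, is (P_{n,l}(z), P_{n,l,1,1}(z), …, P_{n,l,1,r}(z), …, P_{n,l,m,1}(z), …, P_{n,l,m,r}(z)). Then Δ_n(z), a priori a polynomial in K[z], is constant: Δ_n(z) ∈ K for all n ∈ ℕ. -/

import Mathlib

open Polynomial

noncomputable def SPoly (L : Type) [CommRing L] [Algebra ℚ L] (x : ℚ) (n : ℕ)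
    (a : Polynomial L) : Polynomial L :=
  a.sum fun k c =>
    Polynomial.C (c * algebraMap ℚ L ((ascPochhammer ℚ n).eval ((k : ℚ) + x + 1) / n.factorial)) *
      Polynomial.X ^ k

noncomputable def PadeP (L : Type) [CommRing L] [Algebra ℚ L] (x : ℚ) (r m n : ℕ)
    (α : Fin m → L) (l : ℕ) : Polynomial L :=
  (SPoly L x n)^[r] (Polynomial.X ^ l * ∏ i, (Polynomial.X - Polynomial.C (α i)) ^ (r * n))

noncomputable def PadeQ (L : Type) [CommRing L] [Algebra ℚ L] (x : ℚ) (r m n : ℕ)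
    (α : Fin m → L) (l : ℕ) (i : Fin m) (s : ℕ) : Polynomial L :=
  let P := PadeP L x r m n α l
  ∑ a ∈ Finset.range (P.natDegree + 1),
    Polynomial.C (∑ b ∈ Finset.range (P.natDegree + 1),
        P.coeff (a + b + 1) * (α i) ^ (b + 1) * algebraMap ℚ L (1 / (((b : ℚ) + x + 1) ^ s))) *
      Polynomial.X ^ a

/-- The `(rm+1) × (rm+1)` matrix whose `l`-th column is
`(P_{n,l}, P_{n,l,1,1}, …, P_{n,l,1,r}, …, P_{n,l,m,1}, …, P_{n,l,m,r})`. -/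
noncomputable def padeMatrix (K : Type) [Field K] [CharZero K] (x : ℚ) (r m n : ℕ)
    (α : Fin m → K) : Matrix (Fin (r * m + 1)) (Fin (r * m + 1)) (Polynomial K) :=
  fun a l =>
    if ha : (a : ℕ) = 0 then PadeP K x r m n α l
    else
      PadeQ K x r m n α l
        ⟨((a : ℕ) - 1) / r, Nat.div_lt_of_lt_mul (by have := a.isLt; omega)⟩
        (((a : ℕ) - 1) % r + 1)

theorem ascPochhammer_eval_eq_prod {R : Type*} [CommRing R] (n : ℕ) (y : R) :
    (ascPochhammer R n).eval y = ∏ j ∈ Finset.range n, (y + j) := by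
  induction n with
  | zero => simp
  | succ n ih => rw [ascPochhammer_succ_eval, ih, Finset.prod_range_succ]

theorem SPoly_coeff {L : Type} [CommRing L] [Algebra ℚ L] (x : ℚ) (n : ℕ) (a : L[X]) (k : ℕ) :
    (SPoly L x n a).coeff k =
      a.coeff k * algebraMap ℚ L ((ascPochhammer ℚ n).eval ((k : ℚ) + x + 1) / n.factorial) := by
  rw [SPoly, Polynomial.sum, finsetSum_coeff]
  simp only [coeff_C_mul_X_pow]
  rw [Finset.sum_ite_eq]
  split_ifs with h
  · rfl
  · rw [notMem_support_iff.mp h, zero_mul]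

theorem SPoly_iterate_coeff {L : Type} [CommRing L] [Algebra ℚ L] (x : ℚ) (n r : ℕ) (a : L[X])
    (k : ℕ) :
    ((SPoly L x n)^[r] a).coeff k =
      a.coeff k *
        algebraMap ℚ L ((ascPochhammer ℚ n).eval ((k : ℚ) + x + 1) / n.factorial) ^ r := by
  induction r with
  | zero => simp
  | succ r ih => rw [Function.iterate_succ_apply', SPoly_coeff, ih, pow_succ, mul_assoc]

theorem PadeP_natDegree_le {K : Type} [Field K] [CharZero K] (x : ℚ) (r m n : ℕ)
    (α : Fin m → K) (l : ℕ) : (PadeP K x r m n α l).natDegree ≤ l + m * (r * n) := by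
  have hQ : (X ^ l * ∏ i, (X - C (α i)) ^ (r * n)).natDegree ≤ l + m * (r * n) := by
    refine natDegree_mul_le_of_le (natDegree_X_pow_le l) ((natDegree_prod_le _ _).trans ?_)
    refine (Finset.sum_le_card_nsmul _ _ (r * n) fun i _ => ?_).trans (by simp)
    exact (natDegree_pow_le_of_le (r * n) (natDegree_X_sub_C_le (α i))).trans (by simp)
  refine natDegree_le_iff_coeff_eq_zero.mpr fun N hN => ?_
  rw [PadeP, SPoly_iterate_coeff, coeff_eq_zero_of_natDegree_lt (hQ.trans_lt hN), zero_mul]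

/-- A weight of degree less than the vanishing order of `Q` at `α` annihilates `Q` there. -/
theorem sum_coeff_mul_eval_mul_pow_eq_zero {K : Type*} [Field K] (α : K) (M : ℕ) :
    ∀ (q Q : K[X]), q.degree < M → (X - C α) ^ M ∣ Q →
      Q.sum (fun N c => c * q.eval (N : K) * α ^ N) = 0 := by
  induction M with
  | zero =>
    intro q Q hq _
    have : q = 0 := degree_eq_bot.mp (Nat.WithBot.lt_zero_iff.mp (by simpa using hq))
    simp [this, Polynomial.sum]
  | succ M ih =>
    intro q Q hq hQ
    have hdiv : (X - C α) ^ M ∣ X * derivative Q := by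
      have := pow_sub_one_dvd_derivative_of_pow_dvd hQ
      exact Dvd.dvd.mul_left (by simpa using this) _
    have hdeg : q.divX.degree < M := by
      by_cases h0 : q = 0
      · simp [h0]
      rw [degree_lt_iff_coeff_zero] at hq ⊢
      intro k hk
      rw [coeff_divX]
      exact hq _ (by omega)
    have hroot : Q.sum (fun N c => c * α ^ N) = 0 := by
      rw [← eval_eq_sum]
      exact dvd_iff_isRoot.mp ((dvd_pow_self _ M.succ_ne_zero).trans hQ)
    have key := ih q.divX (X * derivative Q) hdeg hdiv
    have hcoeff : ∀ N, (X * derivative Q).coeff N = N * Q.coeff N := by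
      rintro (_ | N)
      · simp
      · rw [coeff_X_mul, coeff_derivative]; push_cast; ring
    rw [sum_over_range' _ (by simp) (Q.natDegree + 1) (by
      refine Nat.lt_succ_of_le (natDegree_le_iff_coeff_eq_zero.mpr fun N hN => ?_)
      rw [hcoeff, coeff_eq_zero_of_natDegree_lt hN, mul_zero])] at key
    rw [sum_over_range _ (by simp)] at hroot ⊢
    calc _ = ∑ N ∈ Finset.range (Q.natDegree + 1),
          ((X * derivative Q).coeff N * q.divX.eval (N : K) * α ^ N
            + q.coeff 0 * (Q.coeff N * α ^ N)) := by
          refine Finset.sum_congr rfl fun N _ => ?_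
          conv_lhs => rw [← divX_mul_X_add q]
          simp only [eval_add, eval_mul, eval_X, eval_C, hcoeff]
          ring
      _ = 0 := by rw [Finset.sum_add_distrib, ← Finset.mul_sum, key, hroot, mul_zero, add_zero]

/-- The orthogonality relations behind the Padé approximation. -/
theorem PadeP_orthogonal {K : Type} [Field K] [CharZero K] (x : ℚ)
    (hx : ∀ k : ℕ, x ≠ -(k + 1 : ℤ)) (r m n : ℕ) (α : Fin m → K) (l : ℕ) (i : Fin m)
    {s : ℕ} (hs : 0 < s) (hsr : s ≤ r) {k : ℕ} (hk : k < n) :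
    ∑ N ∈ Finset.range ((PadeP K x r m n α l).natDegree + 1),
      (PadeP K x r m n α l).coeff N *
        (α i ^ (N + k + 1) * algebraMap ℚ K (1 / (((N + k : ℕ) : ℚ) + x + 1) ^ s)) = 0 := by
  set P := PadeP K x r m n α l with hP
  set Q : K[X] := X ^ l * ∏ i, (X - C (α i)) ^ (r * n) with hQ
  set g : ℚ[X] := ∏ j ∈ (Finset.range n).erase k, (X + C (x + 1 + j)) with hg
  set q : ℚ[X] := C ((1 / (n.factorial : ℚ)) ^ r) * ((X + C (x + 1 + k)) ^ (r - s) * g ^ r) with hq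
  have hasc : ∀ N : ℕ, (ascPochhammer ℚ n).eval ((N : ℚ) + x + 1) =
      ((N : ℚ) + (x + 1 + k)) * g.eval (N : ℚ) := by
    intro N
    rw [ascPochhammer_eval_eq_prod, ← Finset.mul_prod_erase _ _ (Finset.mem_range.mpr hk), hg,
      eval_prod]
    congr 1
    · ring
    · exact Finset.prod_congr rfl fun j _ => by simp; ring
  have hdeg : q.degree < (r * n : ℕ) := by
    have hg' : g.natDegree ≤ n - 1 := by
      refine (natDegree_prod_le _ _).trans ?_
      refine (Finset.sum_le_card_nsmul _ _ 1 fun j _ => (natDegree_X_add_C _).le).trans ?_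
      simp [Finset.card_erase_of_mem (Finset.mem_range.mpr hk)]
    have h : q.natDegree ≤ (r - s) * 1 + r * (n - 1) :=
      (natDegree_C_mul_le _ _).trans <| natDegree_mul_le_of_le
        (natDegree_pow_le_of_le _ (natDegree_X_add_C _).le) (natDegree_pow_le_of_le _ hg')
    refine degree_le_natDegree.trans_lt ?_
    obtain ⟨n, rfl⟩ : ∃ n', n = n' + 1 := ⟨n - 1, by omega⟩
    rw [Nat.add_sub_cancel] at h
    have : r * (n + 1) = r * n + r := by ring
    exact_mod_cast (by omega : q.natDegree < r * (n + 1))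
  have hdvd : (X - C (α i)) ^ (r * n) ∣ Q :=
    Dvd.dvd.mul_left (Finset.dvd_prod_of_mem (fun i => (X - C (α i)) ^ (r * n))
      (Finset.mem_univ i)) _
  have key := sum_coeff_mul_eval_mul_pow_eq_zero (α i) (r * n) (q.map (algebraMap ℚ K)) Q
    (by rwa [degree_map]) hdvd
  have hcoeff : ∀ N, P.coeff N = Q.coeff N *
      algebraMap ℚ K ((ascPochhammer ℚ n).eval ((N : ℚ) + x + 1) / n.factorial) ^ r :=
    fun N => SPoly_iterate_coeff x n r Q N
  have hterm : ∀ N, P.coeff N *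
        (α i ^ (N + k + 1) * algebraMap ℚ K (1 / (((N + k : ℕ) : ℚ) + x + 1) ^ s)) =
      α i ^ (k + 1) * (Q.coeff N * (q.map (algebraMap ℚ K)).eval (N : K) * α i ^ N) := by
    intro N
    have hne : (N : ℚ) + (x + 1 + k) ≠ 0 := fun h => hx (N + k) (by push_cast; linarith)
    have hrat : ((ascPochhammer ℚ n).eval ((N : ℚ) + x + 1) / n.factorial) ^ r *
        (1 / (((N + k : ℕ) : ℚ) + x + 1) ^ s) = q.eval (N : ℚ) := by
      have hNk : ((N + k : ℕ) : ℚ) + x + 1 = (N : ℚ) + (x + 1 + k) := by push_cast; ring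
      obtain ⟨t, rfl⟩ := Nat.exists_eq_add_of_le hsr
      rw [hasc, hNk, hq, Nat.add_sub_cancel_left]
      simp only [eval_mul, eval_C, eval_pow, eval_add, eval_X]
      rw [div_pow, mul_pow, pow_add ((N : ℚ) + (x + 1 + k))]
      field_simp
      rw [mul_assoc, ← mul_pow, mul_one_div_cancel (by positivity), one_pow, mul_one]
    have he : (q.map (algebraMap ℚ K)).eval (N : K) = algebraMap ℚ K (q.eval (N : ℚ)) := by
      rw [← eval_natCast_map]
    rw [hcoeff, he, ← hrat, map_mul, map_pow]
    ring
  have hle : P.natDegree ≤ Q.natDegree := by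
    refine natDegree_le_iff_coeff_eq_zero.mpr fun N hN => ?_
    rw [hcoeff, coeff_eq_zero_of_natDegree_lt hN, zero_mul]
  rw [sum_over_range _ (by simp)] at key
  rw [Finset.sum_subset (Finset.range_mono (Nat.succ_le_succ hle)) fun N _ hN => by
      rw [coeff_eq_zero_of_natDegree_lt (by simpa using hN), zero_mul],
    Finset.sum_congr rfl fun N _ => hterm N, ← Finset.mul_sum, key, mul_zero]

/-- Clearing denominators in the remainder of a Padé-type approximation: if the functional
`t ^ b ↦ φ b` kills `t ^ k * P` for all `k < n`, the truncated remainder drops in degree. -/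
theorem natDegree_remainder_le {K : Type*} [Field K] (P : K[X]) (φ : ℕ → K) {n B : ℕ}
    (hB : P.natDegree + n + 1 ≤ B)
    (h : ∀ k < n, ∑ N ∈ Finset.range (P.natDegree + 1), P.coeff N * φ (N + k) = 0) :
    (X ^ B * (∑ a ∈ Finset.range (P.natDegree + 1),
        C (∑ b ∈ Finset.range (P.natDegree + 1), P.coeff (a + b + 1) * φ b) * X ^ a) -
      (∑ b ∈ Finset.range B, C (φ b) * X ^ (B - 1 - b)) * P).natDegree ≤ B - 1 - n := by
  refine natDegree_le_iff_coeff_eq_zero.mpr fun e he => ?_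
  rw [coeff_sub, coeff_X_pow_mul', Finset.sum_mul, finsetSum_coeff, finsetSum_coeff]
  simp only [mul_assoc, coeff_C_mul, coeff_X_pow_mul', coeff_X_pow, mul_ite, mul_one, mul_zero]
  rw [Finset.sum_ite_eq]
  rcases le_or_gt B e with hBe | hBe
  · have hleft : (if e - B ∈ Finset.range (P.natDegree + 1) then
        ∑ b ∈ Finset.range (P.natDegree + 1), P.coeff (e - B + b + 1) * φ b else 0) =
        ∑ b ∈ Finset.range (P.natDegree + 1), P.coeff (e - B + b + 1) * φ b := by
      split_ifs with hmem
      · rfl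
      · rw [Finset.mem_range] at hmem
        exact (Finset.sum_eq_zero fun b _ => by
          rw [coeff_eq_zero_of_natDegree_lt (by omega), zero_mul]).symm
    rw [if_pos hBe, hleft, sub_eq_zero,
      Finset.sum_subset (Finset.range_mono (by omega : P.natDegree + 1 ≤ B)) fun b _ hb => by
        rw [Finset.mem_range] at hb
        rw [coeff_eq_zero_of_natDegree_lt (by omega), zero_mul]]
    refine Finset.sum_congr rfl fun b hb => ?_
    rw [Finset.mem_range] at hb
    rw [if_pos (by omega), mul_comm, show e - (B - 1 - b) = e - B + b + 1 by omega]
  · rw [if_neg (by omega), zero_sub, neg_eq_zero]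
    obtain ⟨k, hk⟩ : ∃ k, B = (B - k) + k ∧ e = B - 1 - k ∧ k < n := ⟨B - 1 - e, by omega⟩
    obtain ⟨hBk, hek, hkn⟩ := hk
    refine Eq.trans ?_ (h k hkn)
    rw [hBk, add_comm (B - k) k, Finset.sum_range_add, ← hBk.trans (add_comm _ _),
      Finset.sum_eq_zero (s := Finset.range k) fun b hb => by
        rw [Finset.mem_range] at hb
        rw [if_neg (by omega)], zero_add]
    symm
    rw [Finset.sum_subset (Finset.range_mono (by omega : P.natDegree + 1 ≤ B - k)) fun b _ hb => by
        rw [Finset.mem_range] at hb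
        rw [coeff_eq_zero_of_natDegree_lt (by omega), zero_mul]]
    refine Finset.sum_congr rfl fun b hb => ?_
    rw [Finset.mem_range] at hb
    rw [if_pos (by omega), mul_comm, add_comm b k, show e - (B - 1 - (k + b)) = b by omega]

theorem natDegree_det_le_sum {R ι : Type*} [CommRing R] [Fintype ι] [DecidableEq ι]
    (A : Matrix ι ι R[X]) (d : ι → ℕ) (h : ∀ i j, (A i j).natDegree ≤ d i) :
    A.det.natDegree ≤ ∑ i, d i := by
  rw [← Matrix.det_transpose, Matrix.det_apply]
  refine natDegree_sum_le_of_forall_le _ _ fun σ _ => ?_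
  refine (natDegree_smul_le _ _).trans ((natDegree_prod_le _ _).trans ?_)
  exact Finset.sum_le_sum fun i _ => h i (σ i)

/-- Multiplying all rows but the first by `X ^ B` and then reducing them by the first row. -/
theorem natDegree_det_eq_zero_of_row_reduction {R : Type*} [CommRing R] {N B c : ℕ}
    (M : Matrix (Fin (N + 1)) (Fin (N + 1)) R[X]) (F : Fin (N + 1) → R[X]) {d : ℕ}
    (h0 : ∀ l, (M 0 l).natDegree ≤ d)
    (h : ∀ a, a ≠ 0 → ∀ l, (X ^ B * M a l - F a * M 0 l).natDegree ≤ c)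
    (hd : d + N * c ≤ N * B) : M.det.natDegree = 0 := by
  set v : Fin (N + 1) → R[X] := fun a => if a = 0 then 1 else X ^ B with hv
  set A : Matrix (Fin (N + 1)) (Fin (N + 1)) R[X] := Matrix.of fun a l => v a * M a l with hA
  set A' : Matrix (Fin (N + 1)) (Fin (N + 1)) R[X] :=
    Matrix.of fun a l => A a l + (if a = 0 then 0 else -F a) * A 0 l with hA'
  have h1 : A'.det = A.det :=
    Matrix.det_eq_of_forall_row_eq_smul_add_const (fun a => if a = 0 then 0 else -F a) 0 (by simp)
      fun a l => rfl
  have h2 : A.det = X ^ (N * B) * M.det := by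
    rw [hA, Matrix.det_mul_column, Fin.prod_univ_succ]
    simp [hv, ← pow_mul, mul_comm]
  have h3 : A'.det.natDegree ≤ N * B := by
    refine (natDegree_det_le_sum A' (fun a => if a = 0 then d else c) fun a l => ?_).trans ?_
    · by_cases ha : a = 0
      · simpa [hA', hA, hv, ha] using h0 l
      · simpa [hA', hA, hv, ha, sub_eq_add_neg] using h a ha l
    · rw [Fin.sum_univ_succ]
      simpa using hd
  rw [h1, h2] at h3
  refine Nat.le_zero.mp (natDegree_le_iff_coeff_eq_zero.mpr fun e he => ?_)
  rw [← coeff_X_pow_mul M.det (N * B) e]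
  exact coeff_eq_zero_of_natDegree_lt (by omega)

theorem stmt8 (r m : ℕ) (hr : 0 < r) (hm : 0 < m)
    (K : Type) [Field K] [CharZero K]
    (α : Fin m → K) (hα : ∀ i, α i ≠ 0) (hinj : Function.Injective α)
    (halg : ∀ i, IsAlgebraic ℚ (α i))
    (hgen : IntermediateField.adjoin ℚ (Set.range α) = (⊤ : IntermediateField ℚ K))
    (x : ℚ) (hx : ∀ k : ℕ, x ≠ -(k + 1 : ℤ))
    (n : ℕ) (hn : 0 < n) :
    ∃ c : K, (padeMatrix K x r m n α).det = Polynomial.C c := by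
  set d := r * m + m * (r * n) with hd
  set B := d + n + 1 with hB
  set φ : Fin m → ℕ → ℕ → K := fun i s b =>
    α i ^ (b + 1) * algebraMap ℚ K (1 / (((b : ℚ) + x + 1) ^ s)) with hφ
  have hdeg : ∀ l : Fin (r * m + 1), (PadeP K x r m n α l).natDegree ≤ d := fun l =>
    (PadeP_natDegree_le x r m n α l).trans (by have := l.isLt; omega)
  let F : Fin (r * m + 1) → K[X] := fun a =>
    if ha : (a : ℕ) = 0 then 0 else
      ∑ b ∈ Finset.range B, C (φ ⟨((a : ℕ) - 1) / r,
        Nat.div_lt_of_lt_mul (by have := a.isLt; omega)⟩ (((a : ℕ) - 1) % r + 1) b) *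
          X ^ (B - 1 - b)
  refine ⟨_, eq_C_of_natDegree_eq_zero (natDegree_det_eq_zero_of_row_reduction
    (B := B) (c := B - 1 - n) (d := d) _ F (fun l => by simpa [padeMatrix] using hdeg l) ?_ ?_)⟩
  · intro a ha l
    have ha' : (a : ℕ) ≠ 0 := fun h => ha (Fin.ext h)
    have := natDegree_remainder_le (PadeP K x r m n α l)
      (φ ⟨((a : ℕ) - 1) / r, Nat.div_lt_of_lt_mul (by have := a.isLt; omega)⟩
        (((a : ℕ) - 1) % r + 1)) (n := n) (B := B) (by have := hdeg l; omega)
      fun k hk => PadeP_orthogonal x hx r m n α l _ (Nat.succ_pos _) (Nat.mod_lt _ hr) hk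
    simpa only [padeMatrix, PadeQ, F, dif_neg ha', Fin.val_zero, dite_true, hφ, mul_assoc] using this
  · rw [show B - 1 - n = d by omega, hB, hd]
    apply le_of_eq
    ring
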